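/- arXiv:1103.0495 — 2 statements merged into one kernel-verified Lean document; each statement's English description precedes it below -/
import Mathlib

section
/- Let 𝒜 > 0 be given and assume the standing hypotheses (H1)–(H3) with constant d ∈ [0,1). Then there exists M(𝒜) > 0 such that for every integer n > 1 + M(𝒜)/(2−2d) and every u₁ > 0 with A(u₁) ≤ 𝒜 (where A and the U_k are defined with this n), one has A′(u₁) > 0. -/
noncomputable section

/-- `Useq g1 h k` is the function `U_{k+1}` (0-indexed version of the recursion). -/
def Useq (g1 : ℝ → ℝ) (h : ℝ) : ℕ → ℝ → ℝ
  | 0 => fun x => x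
  | 1 => fun x => x + h ^ 2 / 2 * g1 x
  | k + 2 => fun x =>
      2 * Useq g1 h (k + 1) x - Useq g1 h k x + h ^ 2 * g1 (Useq g1 h (k + 1) x)

/-- `discU g1 h k` is the function `U_k` from the paper, for `1 ≤ k`. -/
def discU (g1 : ℝ → ℝ) (h : ℝ) (k : ℕ) : ℝ → ℝ := Useq g1 h (k - 1)

/-- The function `A(u₁)` from the paper. -/
def discA (g1 g2 : ℝ → ℝ) (h : ℝ) (n : ℕ) (x : ℝ) : ℝ :=
  ((discU g1 h n x - discU g1 h (n - 1) x) / h + h / 2 * g1 (discU g1 h n x)) /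
    g2 (discU g1 h n x)

/-- `(u₁, …, u_n)` (encoded as `u : ℕ → ℝ` on indices `1,…,n`) is a positive solution of
the discrete system `(Sα)`. -/
def IsSolution (g1 g2 : ℝ → ℝ) (n : ℕ) (h α : ℝ) (u : ℕ → ℝ) : Prop :=
  (∀ k, 1 ≤ k → k ≤ n → 0 < u k) ∧
  u 2 - u 1 = h ^ 2 / 2 * g1 (u 1) ∧
  (∀ k, 2 ≤ k → k ≤ n - 1 → u (k + 1) - 2 * u k + u (k - 1) = h ^ 2 * g1 (u k)) ∧
  u n - u (n - 1) = -(h ^ 2 / 2) * g1 (u n) + h * α * g2 (u n)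

/-- `G₁`, the primitive of `g₁` vanishing at `0`. -/
def primG1 (g1 : ℝ → ℝ) (x : ℝ) : ℝ := ∫ t in (0:ℝ)..x, g1 t

/-- `g := g₁/g₂`. -/
def gg (g1 g2 : ℝ → ℝ) (x : ℝ) : ℝ := g1 x / g2 x

/-- `G := G₁/g₂²`. -/
def GG (g1 g2 : ℝ → ℝ) (x : ℝ) : ℝ := primG1 g1 x / (g2 x) ^ 2

/-- The trapezoidal-rule error `E` as a function of `u₁`. -/
def trapError (g1 : ℝ → ℝ) (h : ℝ) (n : ℕ) (x : ℝ) : ℝ :=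
  (∑ k ∈ Finset.Icc 1 (n - 1),
    (g1 (discU g1 h k x) + g1 (discU g1 h (k + 1) x)) / 2 *
      (discU g1 h (k + 1) x - discU g1 h k x)) -
  (primG1 g1 (discU g1 h n x) - primG1 g1 (discU g1 h 1 x))

/-- The Jacobian matrix `J(α,u)` of the system `(Sα)`. -/
def Jmat (g1 g2 : ℝ → ℝ) (n : ℕ) (h α : ℝ) (u : ℕ → ℝ) : Matrix (Fin n) (Fin n) ℝ :=
  Matrix.of fun i j =>
    if i = j then
      (if (i : ℕ) = 0 then 1 + h ^ 2 / 2 * deriv g1 (u 1)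
       else if (i : ℕ) = n - 1 then
         1 + h ^ 2 / 2 * deriv g1 (u n) - h * α * deriv g2 (u n)
       else 2 + h ^ 2 * deriv g1 (u ((i : ℕ) + 1)))
    else if (i : ℕ) + 1 = (j : ℕ) ∨ (j : ℕ) + 1 = (i : ℕ) then -1 else 0

open Set

lemma monotoneOn_Ioi_of_hasDerivAt_nonneg {F F' : ℝ → ℝ} {c : ℝ}
    (hF : ∀ x > c, HasDerivAt F (F' x) x) (hF' : ∀ x > c, 0 ≤ F' x) :
    MonotoneOn F (Ioi c) := by
  refine monotoneOn_of_deriv_nonneg (convex_Ioi c)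
    (fun x hx => (hF x hx).continuousAt.continuousWithinAt) ?_ ?_
  · rw [interior_Ioi]
    exact fun x hx => (hF x hx).differentiableAt.differentiableWithinAt
  · rw [interior_Ioi]
    intro x hx
    rw [(hF x hx).deriv]
    exact hF' x hx

lemma mul_sub_le_sub_and_sub_le_mul_sub {F φ : ℝ → ℝ}
    (hF : ∀ x > 0, HasDerivAt F (φ x) x) (hφ : MonotoneOn φ (Ioi 0)) {a b : ℝ}
    (ha : 0 < a) (hab : a ≤ b) :
    φ a * (b - a) ≤ F b - F a ∧ F b - F a ≤ φ b * (b - a) := by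
  rcases hab.eq_or_lt with rfl | hlt
  · simp
  obtain ⟨c, hc, hce⟩ := exists_hasDerivAt_eq_slope F φ hlt
    (fun x hx => (hF x (ha.trans_le hx.1)).continuousAt.continuousWithinAt)
    (fun x hx => hF x (ha.trans hx.1))
  have h0 : 0 < b - a := sub_pos.2 hlt
  have hFc : F b - F a = φ c * (b - a) := by rw [hce]; field_simp
  have hc0 : 0 < c := ha.trans hc.1
  rw [hFc]
  exact ⟨mul_le_mul_of_nonneg_right (hφ ha hc0 hc.1.le) h0.le,
    mul_le_mul_of_nonneg_right (hφ hc0 (hc0.trans hc.2) hc.2.le) h0.le⟩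

/-- The trapezoidal rule overestimates the integral of a convex function. -/
lemma two_mul_sub_le_trapezoid {F φ φ' : ℝ → ℝ}
    (hF : ∀ x > 0, HasDerivAt F (φ x) x) (hφ : ∀ x > 0, HasDerivAt φ (φ' x) x)
    (hφ' : MonotoneOn φ' (Ioi 0)) {a b : ℝ} (ha : 0 < a) (hab : a ≤ b) :
    2 * (F b - F a) ≤ (b - a) * (φ a + φ b) := by
  have key : MonotoneOn (fun t => (t - a) * (φ a + φ t) - 2 * (F t - F a)) (Icc a b) := by
    have hd : ∀ x ∈ Icc a b, HasDerivAt (fun t => (t - a) * (φ a + φ t) - 2 * (F t - F a))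
        (1 * (φ a + φ x) + (x - a) * φ' x - 2 * φ x) x := fun x hx => by
      have hx0 : 0 < x := ha.trans_le hx.1
      exact (((hasDerivAt_id x).sub_const a).mul ((hφ x hx0).const_add (φ a))).sub
        (((hF x hx0).sub_const (F a)).const_mul 2)
    refine monotoneOn_of_deriv_nonneg (convex_Icc a b)
      (fun x hx => (hd x hx).continuousAt.continuousWithinAt)
      (fun x hx => (hd x (interior_subset hx)).differentiableAt.differentiableWithinAt) ?_
    intro x hx
    have hx := interior_subset hx
    rw [(hd x hx).deriv]
    have := (mul_sub_le_sub_and_sub_le_mul_sub hφ hφ' ha hx.1).2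
    nlinarith
  have := key (left_mem_Icc.2 hab) (right_mem_Icc.2 hab) hab
  simp only [sub_self, zero_mul, mul_zero] at this
  linarith

/-- Inequalities on `(0, ∞)` satisfied by a reaction term `g` with derivative `f` and primitive
`G`, when `g` and `f` are convex and increasing and `g` and `G` vanish at `0`. -/
structure ReactionBounds (G g f : ℝ → ℝ) : Prop where
  g_pos : ∀ {a}, 0 < a → 0 < g a
  f_pos : ∀ {a}, 0 < a → 0 < f a
  G_pos : ∀ {a}, 0 < a → 0 < G a
  f_mono : MonotoneOn f (Ioi 0)
  g_mono : MonotoneOn g (Ioi 0)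
  g_sub_le : ∀ {a b}, 0 < a → a ≤ b → g b - g a ≤ f b * (b - a)
  g_trapezoid : ∀ {a b}, 0 < a → a ≤ b → 2 * (g b - g a) ≤ (b - a) * (f a + f b)
  G_sub_ge : ∀ {a b}, 0 < a → a ≤ b → g a * (b - a) ≤ G b - G a
  G_trapezoid : ∀ {a b}, 0 < a → a ≤ b → 2 * (G b - G a) ≤ (b - a) * (g a + g b)
  sq_le : ∀ {a}, 0 < a → g a ^ 2 ≤ 2 * G a * f a
  div_le : ∀ {a b}, 0 < a → a ≤ b → 2 * G b / g b ≤ 2 * G a / g a + (b - a)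

lemma hasDerivAt_primG1 {g : ℝ → ℝ} (hg : Continuous g) (x : ℝ) :
    HasDerivAt (primG1 g) (g x) x :=
  intervalIntegral.integral_hasDerivAt_right (hg.intervalIntegrable _ _)
    hg.aestronglyMeasurable.stronglyMeasurableAtFilter hg.continuousAt

lemma pos_of_hasDerivAt_pos {F φ : ℝ → ℝ} (hF : ∀ x, HasDerivAt F (φ x) x) (h0 : F 0 = 0)
    (hφ : ∀ x > 0, 0 < φ x) {x : ℝ} (hx : 0 < x) : 0 < F x := by
  have : StrictMonoOn F (Ici 0) := strictMonoOn_of_deriv_pos (convex_Ici 0)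
    (fun x _ => (hF x).continuousAt.continuousWithinAt) (by
      rw [interior_Ici]
      intro y hy
      rw [(hF y).deriv]
      exact hφ y hy)
  simpa [h0] using this self_mem_Ici hx.le hx

lemma reactionBounds {g : ℝ → ℝ} (hg : ContDiff ℝ 3 g) (hg0 : g 0 = 0)
    (hd : ∀ x > (0:ℝ), 0 < deriv g x) (hdd : ∀ x > (0:ℝ), 0 < deriv (deriv g) x)
    (hddd : ∀ x > (0:ℝ), 0 ≤ deriv (deriv (deriv g)) x) :
    ReactionBounds (primG1 g) g (deriv g) := by
  have c1 : ContDiff ℝ 2 (deriv g) := ((contDiff_succ_iff_deriv (n := 2)).1 hg).2.2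
  have c2 : ContDiff ℝ 1 (deriv (deriv g)) := ((contDiff_succ_iff_deriv (n := 1)).1 c1).2.2
  have d0 : ∀ x, HasDerivAt g (deriv g x) x := fun x =>
    (hg.differentiable (by norm_num)).differentiableAt.hasDerivAt
  have d1 : ∀ x, HasDerivAt (deriv g) (deriv (deriv g) x) x := fun x =>
    (c1.differentiable (by norm_num)).differentiableAt.hasDerivAt
  have d2 : ∀ x, HasDerivAt (deriv (deriv g)) (deriv (deriv (deriv g)) x) x := fun x =>
    (c2.differentiable (by norm_num)).differentiableAt.hasDerivAt
  have dG : ∀ x, HasDerivAt (primG1 g) (g x) x := hasDerivAt_primG1 hg.continuous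
  have hG0 : primG1 g 0 = 0 := by simp [primG1]
  have gpos : ∀ x > 0, 0 < g x := fun x hx => pos_of_hasDerivAt_pos d0 hg0 hd hx
  have Gpos : ∀ x > 0, 0 < primG1 g x := fun x hx => pos_of_hasDerivAt_pos dG hG0 gpos hx
  have m2 : MonotoneOn (deriv (deriv g)) (Ioi 0) :=
    monotoneOn_Ioi_of_hasDerivAt_nonneg (fun x _ => d2 x) hddd
  have m1 : MonotoneOn (deriv g) (Ioi 0) :=
    monotoneOn_Ioi_of_hasDerivAt_nonneg (fun x _ => d1 x) fun x hx => (hdd x hx).le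
  have m0 : MonotoneOn g (Ioi 0) :=
    monotoneOn_Ioi_of_hasDerivAt_nonneg (fun x _ => d0 x) fun x hx => (hd x hx).le
  have sq : ∀ x > 0, g x ^ 2 ≤ 2 * primG1 g x * deriv g x := by
    intro x hx
    have hD : ∀ y, HasDerivAt (fun t => 2 * primG1 g t * deriv g t - g t ^ 2)
        (2 * primG1 g y * deriv (deriv g) y) y := fun y =>
      ((((dG y).const_mul 2).mul (d1 y)).sub ((d0 y).pow 2)).congr_deriv (by norm_num)
    have := pos_of_hasDerivAt_pos hD (by simp [hG0, hg0])
      (fun y hy => mul_pos (mul_pos two_pos (Gpos y hy)) (hdd y hy)) hx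
    linarith
  refine ⟨fun h => gpos _ h, fun h => hd _ h, fun h => Gpos _ h, m1, m0,
    fun ha hab => (mul_sub_le_sub_and_sub_le_mul_sub (fun x _ => d0 x) m1 ha hab).2,
    fun ha hab => two_mul_sub_le_trapezoid (fun x _ => d0 x) (fun x _ => d1 x) m2 ha hab,
    fun ha hab => (mul_sub_le_sub_and_sub_le_mul_sub (fun x _ => dG x) m0 ha hab).1,
    fun ha hab => two_mul_sub_le_trapezoid (fun x _ => dG x) (fun x _ => d0 x) m1 ha hab,
    fun h => sq _ h, ?_⟩
  intro a b ha hab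
  have hD : ∀ y > 0, HasDerivAt (fun t => t - 2 * primG1 g t / g t)
      (1 - (2 * g y * g y - 2 * primG1 g y * deriv g y) / g y ^ 2) y := fun y hy =>
    (hasDerivAt_id y).sub (((dG y).const_mul 2).div (d0 y) (gpos y hy).ne')
  have := monotoneOn_Ioi_of_hasDerivAt_nonneg hD (fun y hy => by
    rw [sub_nonneg, div_le_one (pow_pos (gpos y hy) 2)]
    nlinarith [sq y hy]) ha (ha.trans_le hab) hab
  simp only at this
  linarith

/-- A discrete trajectory `u` with velocities `v`, together with its variation `y` with respect
to the starting point and the velocities `z` of that variation. -/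
structure DiscreteTrajectory (g f : ℝ → ℝ) (h : ℝ) (u v y z : ℕ → ℝ) : Prop where
  u_succ : ∀ k, u (k + 1) = u k + h * v k
  v_zero : v 0 = h / 2 * g (u 0)
  v_succ : ∀ k, v (k + 1) = v k + h * g (u (k + 1))
  y_zero : y 0 = 1
  y_succ : ∀ k, y (k + 1) = y k + h * z k
  z_zero : z 0 = h / 2 * f (u 0)
  z_succ : ∀ k, z (k + 1) = z k + h * (f (u (k + 1)) * y (k + 1))

namespace DiscreteTrajectory

variable {G g f : ℝ → ℝ} {h : ℝ} {u v y z : ℕ → ℝ}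

lemma pos (T : DiscreteTrajectory g f h u v y z) (B : ReactionBounds G g f) (hh : 0 < h)
    (h0 : 0 < u 0) (k : ℕ) : 0 < u k ∧ 0 < v k := by
  induction k with
  | zero => exact ⟨h0, by rw [T.v_zero]; have := B.g_pos h0; positivity⟩
  | succ k ih =>
    obtain ⟨hu, hv⟩ := ih
    have hu' : 0 < u (k + 1) := by rw [T.u_succ]; positivity
    have := B.g_pos hu'
    exact ⟨hu', by rw [T.v_succ]; positivity⟩

lemma strictMono (T : DiscreteTrajectory g f h u v y z) (B : ReactionBounds G g f) (hh : 0 < h)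
    (h0 : 0 < u 0) : StrictMono u :=
  strictMono_nat_of_lt_succ fun k => by
    rw [T.u_succ]
    have := mul_pos hh (T.pos B hh h0 k).2
    linarith

lemma velocity_le (T : DiscreteTrajectory g f h u v y z) (B : ReactionBounds G g f) (hh : 0 < h)
    (h0 : 0 < u 0) (k : ℕ) : v k ≤ (k + 1) * h * g (u k) := by
  induction k with
  | zero =>
    rw [T.v_zero]
    have := mul_pos hh (B.g_pos h0)
    push_cast
    linarith
  | succ k ih =>
    have hm : g (u k) ≤ g (u (k + 1)) := B.g_mono (T.pos B hh h0 k).1 (T.pos B hh h0 (k + 1)).1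
      ((T.strictMono B hh h0).monotone k.le_succ)
    have hk : (0:ℝ) ≤ (k + 1) * h := by positivity
    have := mul_le_mul_of_nonneg_left hm hk
    rw [T.v_succ]
    push_cast
    linarith

lemma le_velocity (T : DiscreteTrajectory g f h u v y z) (B : ReactionBounds G g f) (hh : 0 < h)
    (h0 : 0 < u 0) (k : ℕ) : (k + 1 / 2) * h * g (u 0) ≤ v k := by
  induction k with
  | zero =>
    rw [T.v_zero]
    push_cast
    linarith
  | succ k ih =>
    have hm : g (u 0) ≤ g (u (k + 1)) := B.g_mono h0 (T.pos B hh h0 (k + 1)).1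
      ((T.strictMono B hh h0).monotone (Nat.zero_le _))
    have := mul_le_mul_of_nonneg_left hm hh.le
    rw [T.v_succ]
    push_cast
    linarith

/-- The variation dominates the trajectory, at the rate given by the starting point. -/
lemma variation_ge (T : DiscreteTrajectory g f h u v y z) (B : ReactionBounds G g f)
    (hh : 0 < h) (h0 : 0 < u 0) (k : ℕ) :
    1 + g (u 0) / (2 * G (u 0)) * (u k - u 0) ≤ y k ∧
      g (u 0) / (2 * G (u 0)) * v k ≤ z k := by
  have hg := B.g_pos h0
  have hG := B.G_pos h0
  set c := g (u 0) / (2 * G (u 0)) with hc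
  have hc0 : 0 < c := by positivity
  have hcψ : c * (2 * G (u 0) / g (u 0)) = 1 := by rw [hc]; field_simp
  have reaction : ∀ k, 1 + c * (u k - u 0) ≤ y k → c * g (u k) ≤ f (u k) * y k := by
    intro k hk
    have hu := (T.pos B hh h0 k).1
    have hgk := B.g_pos hu
    have hfk := B.f_pos hu
    have h1 := mul_le_mul_of_nonneg_left
      (B.div_le h0 ((T.strictMono B hh h0).monotone (Nat.zero_le k))) hc0.le
    have h2 : c * (2 * G (u k) / g (u k)) ≤ y k := by linarith
    have h3 : g (u k) ≤ f (u k) * (2 * G (u k) / g (u k)) := by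
      rw [← mul_div_assoc, le_div_iff₀ hgk]
      linarith [B.sq_le hu]
    calc c * g (u k) ≤ c * (f (u k) * (2 * G (u k) / g (u k))) :=
          mul_le_mul_of_nonneg_left h3 hc0.le
      _ = f (u k) * (c * (2 * G (u k) / g (u k))) := by ring
      _ ≤ f (u k) * y k := mul_le_mul_of_nonneg_left h2 hfk.le
  induction k with
  | zero =>
    have hy : 1 + c * (u 0 - u 0) ≤ y 0 := by rw [T.y_zero]; simp
    refine ⟨hy, ?_⟩
    have := mul_le_mul_of_nonneg_left (reaction 0 hy) hh.le
    rw [T.y_zero] at this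
    rw [T.v_zero, T.z_zero]
    linarith
  | succ k ih =>
    have hy : 1 + c * (u (k + 1) - u 0) ≤ y (k + 1) := by
      rw [T.u_succ, T.y_succ]
      have := mul_le_mul_of_nonneg_left ih.2 hh.le
      linarith [ih.1]
    refine ⟨hy, ?_⟩
    have := mul_le_mul_of_nonneg_left (reaction _ hy) hh.le
    rw [T.v_succ, T.z_succ]
    linarith [ih.2]

lemma variation_pos (T : DiscreteTrajectory g f h u v y z) (B : ReactionBounds G g f)
    (hh : 0 < h) (h0 : 0 < u 0) (k : ℕ) : 0 < y k ∧ 0 < z k := by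
  have hg := B.g_pos h0
  have hG := B.G_pos h0
  have hv := (T.pos B hh h0 k).2
  have hu : 0 ≤ u k - u 0 := sub_nonneg.2 ((T.strictMono B hh h0).monotone (Nat.zero_le k))
  obtain ⟨h1, h2⟩ := T.variation_ge B hh h0 k
  exact ⟨lt_of_lt_of_le (by positivity) h1, lt_of_lt_of_le (by positivity) h2⟩

/-- The logarithmic variation of `G` along the trajectory is at least its initial value. -/
lemma log_variation_ge (T : DiscreteTrajectory g f h u v y z) (B : ReactionBounds G g f)
    (hh : 0 < h) (h0 : 0 < u 0) (k : ℕ) :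
    g (u 0) * G (u k) ≤ G (u 0) * (g (u k) * y k) := by
  have hg := B.g_pos h0
  have hG := B.G_pos h0
  have hgk := B.g_pos (T.pos B hh h0 k).1
  have h1 := B.div_le h0 ((T.strictMono B hh h0).monotone (Nat.zero_le k))
  have h2 := mul_le_mul_of_nonneg_left h1 (by positivity : 0 ≤ g (u 0) / (2 * G (u 0)))
  have h3 : g (u 0) / (2 * G (u 0)) * (2 * G (u k) / g (u k)) ≤ y k := by
    refine h2.trans (le_trans (le_of_eq ?_) (T.variation_ge B hh h0 k).1)
    field_simp
  have h4 : g (u 0) / (2 * G (u 0)) * (2 * G (u k) / g (u k)) =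
      g (u 0) * G (u k) / (G (u 0) * g (u k)) := by field_simp
  rw [h4, div_le_iff₀ (by positivity)] at h3
  linarith

/-- The discrete kinetic energy dominates the potential difference. -/
lemma energy_ge (T : DiscreteTrajectory g f h u v y z) (B : ReactionBounds G g f)
    (hh : 0 < h) (h0 : 0 < u 0) (k : ℕ) :
    2 * (G (u k) - G (u 0)) ≤ (v k - h / 2 * g (u k)) ^ 2 := by
  induction k with
  | zero => rw [T.v_zero]; simp
  | succ k ih =>
    have hu := (T.pos B hh h0 k).1
    have hle := T.strictMono B hh h0 |>.monotone k.le_succ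
    have hgk := B.g_pos hu
    have hm := B.g_mono hu (T.pos B hh h0 (k + 1)).1 hle
    have ht := B.G_trapezoid hu hle
    have hd : u (k + 1) - u k = h * v k := by rw [T.u_succ]; ring
    rw [hd] at ht
    rw [T.v_succ]
    have : 0 ≤ h ^ 2 * (g (u (k + 1)) ^ 2 - g (u k) ^ 2) :=
      mul_nonneg (sq_nonneg h) (by nlinarith)
    nlinarith

/-- The variation of the discrete kinetic energy dominates that of the potential difference. -/
lemma energy_variation_ge (T : DiscreteTrajectory g f h u v y z) (B : ReactionBounds G g f)
    (hh : 0 < h) (h0 : 0 < u 0) (k : ℕ) :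
    g (u k) * y k - g (u 0) ≤
      (v k - h / 2 * g (u k)) * (z k - h / 2 * (f (u k) * y k)) := by
  induction k with
  | zero => rw [T.v_zero, T.y_zero]; simp
  | succ k ih =>
    have hu := (T.pos B hh h0 k).1
    have hu' := (T.pos B hh h0 (k + 1)).1
    have hle := T.strictMono B hh h0 |>.monotone k.le_succ
    have hga := B.g_pos hu
    have hgb := B.g_pos hu'
    have hfa := B.f_pos hu
    have hfb := B.f_pos hu'
    have hgm := B.g_mono hu hu' hle
    have hfm := B.f_mono hu hu' hle
    obtain ⟨hy, hz⟩ := T.variation_pos B hh h0 k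
    have ht := B.g_trapezoid hu hle
    have hs := B.g_sub_le hu hle
    have hd : u (k + 1) - u k = h * v k := by rw [T.u_succ]; ring
    rw [hd] at ht hs
    have e1 := mul_nonneg (mul_pos hh hz).le (sub_nonneg.2 hs)
    have e2 := mul_nonneg hy.le (sub_nonneg.2 ht)
    have e3 : 0 ≤ h ^ 2 * (g (u (k + 1)) * f (u (k + 1)) * (h * z k)) := by positivity
    have e4 : 0 ≤ h ^ 2 * (y k * (g (u (k + 1)) * f (u (k + 1)) - g (u k) * f (u k))) :=
      mul_nonneg (sq_nonneg h) (mul_nonneg hy.le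
        (sub_nonneg.2 (mul_le_mul hgm hfm hfa.le hgb.le)))
    rw [T.v_succ, T.z_succ, T.y_succ]
    linarith

/-- Over a unit time interval the discrete kinetic energy exceeds the potential difference by
a relative error of order `h` at most. -/
lemma energy_le (T : DiscreteTrajectory g f h u v y z) (B : ReactionBounds G g f)
    (hh : 0 < h) (hh1 : h ≤ 1) (h0 : 0 < u 0) {L : ℝ} (k : ℕ) (hk : k * h ≤ 1)
    (hL : f (u k) ≤ L) :
    (v k - h / 2 * g (u k)) ^ 2 ≤ (2 + h * (2 * L + L ^ 2)) * (G (u k) - G (u 0)) := by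
  induction k with
  | zero => rw [T.v_zero]; simp
  | succ k ih =>
    push_cast at hk
    have hu := (T.pos B hh h0 k).1
    have hu' := (T.pos B hh h0 (k + 1)).1
    have hle := T.strictMono B hh h0 |>.monotone k.le_succ
    have hv := (T.pos B hh h0 k).2
    have ih := ih (by linarith) ((B.f_mono hu hu' hle).trans hL)
    have hL0 : 0 < L := (B.f_pos hu').trans_le hL
    have hga := B.g_pos hu
    have hva : v k ≤ g (u k) := (T.velocity_le B hh h0 k).trans
      (mul_le_of_le_one_left hga.le hk)
    have hd : u (k + 1) - u k = h * v k := by rw [T.u_succ]; ring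
    have hG := B.G_sub_ge hu hle
    have hs := B.g_sub_le hu hle
    rw [hd] at hG hs
    have hhv : 0 < h * v k := mul_pos hh hv
    have hs1 : g (u (k + 1)) - g (u k) ≤ L * (h * v k) :=
      hs.trans (mul_le_mul_of_nonneg_right hL hhv.le)
    have hs2 : g (u (k + 1)) - g (u k) ≤ L * h * g (u k) := hs1.trans (by
      rw [mul_assoc]
      gcongr)
    have hsum : 0 < g (u k) + g (u (k + 1)) := add_pos hga (B.g_pos hu')
    have h1 : h ^ 2 / 4 * ((g (u (k + 1)) - g (u k)) * (g (u k) + g (u (k + 1)))) ≤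
        h ^ 2 / 4 * (L * (h * v k) * (g (u k) + g (u (k + 1)))) := by gcongr
    have h2 : (1 + h ^ 2 / 4 * L) * (h * v k) * (g (u k) + g (u (k + 1))) ≤
        (1 + h ^ 2 / 4 * L) * (h * v k) * ((2 + L * h) * g (u k)) := by
      gcongr
      linarith
    have hsq : h ^ 2 ≤ h := by nlinarith
    have hcu : h ^ 3 ≤ h := by nlinarith [sq_nonneg h]
    have h3 : (1 + h ^ 2 / 4 * L) * (2 + L * h) ≤ 2 + h * (2 * L + L ^ 2) := by
      nlinarith [mul_le_mul_of_nonneg_right hsq hL0.le,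
        mul_le_mul_of_nonneg_right hcu (sq_nonneg L), mul_pos hh hL0, mul_pos hh (pow_pos hL0 2)]
    have h4 : (1 + h ^ 2 / 4 * L) * (2 + L * h) * (g (u k) * (h * v k)) ≤
        (2 + h * (2 * L + L ^ 2)) * (G (u (k + 1)) - G (u k)) :=
      mul_le_mul h3 hG (by positivity) (by positivity)
    rw [T.v_succ]
    linarith

end DiscreteTrajectory

/-- The endpoint `U` of a trajectory started at `x` is bounded in terms of the boundary flux. -/
lemma exists_endpoint_bound {G₁ g₁ g₂ : ℝ → ℝ}
    (hG₁ : ∀ x > 0, 0 < G₁ x) (hg₁ : ∀ x > 0, 0 < g₁ x) (hg₂ : ∀ x > 0, 0 < g₂ x)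
    (hG₁m : MonotoneOn G₁ (Ioi 0)) (hg₂m : MonotoneOn g₂ (Ioi 0))
    (hgmono : StrictMonoOn (fun x => g₁ x / g₂ x) (Ioi 0))
    (hgbij : BijOn (fun x => g₁ x / g₂ x) (Ioi 0) (Ioi 0))
    (hGmono : StrictMonoOn (fun x => G₁ x / g₂ x ^ 2) (Ioi 0))
    (hGbij : BijOn (fun x => G₁ x / g₂ x ^ 2) (Ioi 0) (Ioi 0)) {α : ℝ} (hα : 0 < α) :
    ∃ C > 0, ∀ x U W : ℝ, 0 < x → x ≤ U → g₁ x ≤ W → 2 * (G₁ U - G₁ x) ≤ W ^ 2 →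
      W ≤ α * g₂ U → U ≤ C := by
  obtain ⟨c₁, hc₁, hc₁e⟩ := hGbij.surjOn (show α ^ 2 ∈ Ioi (0:ℝ) from pow_pos hα 2)
  obtain ⟨c₂, hc₂, hc₂e⟩ := hgbij.surjOn (show 2 * α ∈ Ioi (0:ℝ) from mul_pos two_pos hα)
  have hc₂0 : 0 < c₂ := hc₂
  have hGc₂ := hG₁ c₂ hc₂
  have hgc₂ := hg₂ c₂ hc₂
  obtain ⟨c₃, hc₃, hc₃e⟩ := hGbij.surjOn
    (show 2 * (G₁ c₂ / g₂ c₂ ^ 2) ∈ Ioi (0:ℝ) from by simp only [mem_Ioi]; positivity)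
  refine ⟨max c₁ (max c₂ c₃), lt_max_of_lt_left hc₁, fun x U W hx hxU hW hE hA => ?_⟩
  have hU : 0 < U := hx.trans_le hxU
  have hgU := hg₂ U hU
  have hW0 : 0 < W := (hg₁ x hx).trans_le hW
  have hWsq : W ^ 2 ≤ α ^ 2 * g₂ U ^ 2 := by
    rw [← mul_pow]
    exact pow_le_pow_left₀ hW0.le hA 2
  simp only at hc₁e hc₂e hc₃e
  rcases le_or_gt (2 * G₁ x) (G₁ U) with h | h
  · refine le_max_of_le_left ((hGmono.le_iff_le hU hc₁).1 ?_)
    rw [hc₁e, div_le_iff₀ (pow_pos hgU 2)]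
    linarith
  refine le_max_of_le_right ?_
  have hgx := hg₂ x hx
  have hr := hGmono.monotoneOn hx hU hxU
  rw [div_le_div_iff₀ (pow_pos hgx 2) (pow_pos hgU 2)] at hr
  have hsq : g₂ U ^ 2 ≤ 2 * g₂ x ^ 2 := by
    have : G₁ x * g₂ U ^ 2 ≤ G₁ x * (2 * g₂ x ^ 2) := by nlinarith [pow_pos hgx 2]
    exact le_of_mul_le_mul_left this (hG₁ x hx)
  have hxc : x ≤ c₂ := by
    refine (hgmono.le_iff_le hx hc₂).1 ?_
    rw [hc₂e, div_le_iff₀ hgx]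
    refine (pow_le_pow_iff_left₀ (hg₁ x hx).le (by positivity) two_ne_zero).1 ?_
    have := pow_le_pow_left₀ (hg₁ x hx).le hW 2
    nlinarith [pow_pos hα 2, pow_pos (mul_pos hα hgx) 2]
  rcases le_total U c₂ with hUc | hUc
  · exact le_max_of_le_left hUc
  refine le_max_of_le_right ((hGmono.le_iff_le hU hc₃).1 ?_)
  rw [hc₃e, div_le_iff₀ (pow_pos hgU 2)]
  have h1 : G₁ U ≤ 2 * G₁ c₂ := h.le.trans (by linarith [hG₁m hx hc₂ hxc])
  have h2 : g₂ c₂ ^ 2 ≤ g₂ U ^ 2 := pow_le_pow_left₀ hgc₂.le (hg₂m hc₂ hU hUc) 2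
  have h3 : 2 * (G₁ c₂ / g₂ c₂ ^ 2) * g₂ c₂ ^ 2 = 2 * G₁ c₂ := by field_simp
  have h4 : 2 * (G₁ c₂ / g₂ c₂ ^ 2) * g₂ c₂ ^ 2 ≤ 2 * (G₁ c₂ / g₂ c₂ ^ 2) * g₂ U ^ 2 := by
    gcongr
  linarith

/-- The forward differences of `Useq`, divided by the step. -/
def velocitySeq (g : ℝ → ℝ) (h : ℝ) : ℕ → ℝ → ℝ
  | 0 => fun x => h / 2 * g x
  | k + 1 => fun x => velocitySeq g h k x + h * g (Useq g h (k + 1) x)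

lemma Useq_succ (g : ℝ → ℝ) (h : ℝ) (k : ℕ) (x : ℝ) :
    Useq g h (k + 1) x = Useq g h k x + h * velocitySeq g h k x := by
  induction k with
  | zero => simp only [Useq, velocitySeq]; ring
  | succ k ih =>
    simp only [velocitySeq, mul_add]
    rw [Useq]
    linarith

lemma differentiable_Useq {g : ℝ → ℝ} (hg : Differentiable ℝ g) (h : ℝ) (k : ℕ) :
    Differentiable ℝ (Useq g h k) ∧ Differentiable ℝ (velocitySeq g h k) := by
  induction k with
  | zero => exact ⟨differentiable_id, hg.const_mul _⟩
  | succ k ih =>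
    have hu : Differentiable ℝ (Useq g h (k + 1)) := by
      rw [funext (Useq_succ g h k)]
      exact ih.1.add (ih.2.const_mul h)
    exact ⟨hu, ih.2.add ((hg.comp hu).const_mul h)⟩

lemma discreteTrajectory {g : ℝ → ℝ} (hg : Differentiable ℝ g) (h x : ℝ) :
    DiscreteTrajectory g (deriv g) h (fun k => Useq g h k x) (fun k => velocitySeq g h k x)
      (fun k => deriv (Useq g h k) x) (fun k => deriv (velocitySeq g h k) x) where
  u_succ k := Useq_succ g h k x
  v_zero := rfl
  v_succ k := rfl
  y_zero := deriv_id x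
  y_succ k := by
    obtain ⟨hu, hv⟩ := differentiable_Useq hg h k
    rw [funext (Useq_succ g h k)]
    exact ((hu x).hasDerivAt.add ((hv x).hasDerivAt.const_mul h)).deriv
  z_zero := ((hg x).hasDerivAt.const_mul (h / 2)).deriv
  z_succ k := by
    have hu := (differentiable_Useq hg h (k + 1)).1
    have hv := (differentiable_Useq hg h k).2
    exact ((hv x).hasDerivAt.add
      (((hg _).hasDerivAt.comp x (hu x).hasDerivAt).const_mul h)).deriv

lemma discA_eq (g₁ g₂ : ℝ → ℝ) {h : ℝ} (hh : h ≠ 0) (p : ℕ) (x : ℝ) :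
    discA g₁ g₂ h (p + 2) x =
      (velocitySeq g₁ h (p + 1) x - h / 2 * g₁ (Useq g₁ h (p + 1) x)) /
        g₂ (Useq g₁ h (p + 1) x) := by
  have h1 : (Useq g₁ h (p + 1) x - Useq g₁ h p x) / h = velocitySeq g₁ h p x := by
    rw [Useq_succ]; field_simp; ring
  have h2 : velocitySeq g₁ h (p + 1) x =
    velocitySeq g₁ h p x + h * g₁ (Useq g₁ h (p + 1) x) := rfl
  simp only [discA, discU, Nat.add_sub_cancel, show p + 2 - 1 = p + 1 by omega]
  rw [h1, h2]
  ring

theorem stmt_13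
    (g1 g2 : ℝ → ℝ)
    (hg1C : ContDiff ℝ 3 g1) (hg2C : ContDiff ℝ 3 g2)
    (hg10 : g1 0 = 0) (hg20 : g2 0 = 0)
    (hg1d : ∀ x > (0:ℝ), 0 < deriv g1 x) (hg2d : ∀ x > (0:ℝ), 0 < deriv g2 x)
    (hg1dd : ∀ x > (0:ℝ), 0 < deriv (deriv g1) x)
    (hg2dd : ∀ x > (0:ℝ), 0 < deriv (deriv g2) x)
    (hg1ddd : ∀ x > (0:ℝ), 0 ≤ deriv (deriv (deriv g1)) x)
    (hg2ddd : ∀ x > (0:ℝ), 0 ≤ deriv (deriv (deriv g2)) x)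
    (𝒜 : ℝ) (h𝒜 : 0 < 𝒜)
    (hgmono : StrictMonoOn (gg g1 g2) (Set.Ioi 0))
    (hgbij : Set.BijOn (gg g1 g2) (Set.Ioi 0) (Set.Ioi 0))
    (hGmono : StrictMonoOn (GG g1 g2) (Set.Ioi 0))
    (hGbij : Set.BijOn (GG g1 g2) (Set.Ioi 0) (Set.Ioi 0))
    (d : ℝ) (hd0 : 0 ≤ d) (hd1 : d < 1)
    (hH2 : ∀ x > (0:ℝ), 0 ≤ d * g1 x / primG1 g1 x - 2 * deriv g2 x / g2 x)
    (hH3 : ∀ x > (0:ℝ), 0 ≤ deriv (deriv (GG g1 g2)) x) :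
    ∃ M > (0:ℝ), ∀ n : ℕ, 1 + M / (2 - 2 * d) < (n : ℝ) →
      ∀ u1 > (0:ℝ), discA g1 g2 (1 / ((n : ℝ) - 1)) n u1 ≤ 𝒜 →
        0 < deriv (discA g1 g2 (1 / ((n : ℝ) - 1)) n) u1 := by
  have hg1D : Differentiable ℝ g1 := hg1C.differentiable (by norm_num)
  have hg2D : Differentiable ℝ g2 := hg2C.differentiable (by norm_num)
  have B := reactionBounds hg1C hg10 hg1d hg1dd hg1ddd
  have B2 := reactionBounds hg2C hg20 hg2d hg2dd hg2ddd
  have hG1m : MonotoneOn (primG1 g1) (Set.Ioi 0) :=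
    monotoneOn_Ioi_of_hasDerivAt_nonneg (fun x _ => hasDerivAt_primG1 hg1C.continuous x)
      fun x hx => (B.g_pos hx).le
  obtain ⟨C, hC, hbound⟩ := exists_endpoint_bound (fun _ => B.G_pos) (fun _ => B.g_pos)
    (fun _ => B2.g_pos) hG1m B2.g_mono hgmono hgbij hGmono hGbij h𝒜
  have hL : 0 < deriv g1 C := B.f_pos hC
  set L := deriv g1 C
  refine ⟨2 * L + L ^ 2, by positivity, fun n hn x hx hA => ?_⟩
  have hd2 : 0 < 2 - 2 * d := by linarith
  have hn1 : (1:ℝ) < n := lt_of_le_of_lt (by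
    have : 0 ≤ (2 * L + L ^ 2) / (2 - 2 * d) := by positivity
    linarith) hn
  obtain ⟨p, rfl⟩ : ∃ p, n = p + 2 := ⟨n - 2, by
    have : 1 < n := by exact_mod_cast hn1
    omega⟩
  have hcast : ((p + 2 : ℕ) : ℝ) - 1 = p + 1 := by push_cast; ring
  rw [hcast] at hA ⊢
  have hp : (0:ℝ) < p + 1 := by positivity
  have hM : 1 / ((p : ℝ) + 1) * (2 * L + L ^ 2) < 2 - 2 * d := by
    rw [one_div_mul_eq_div, div_lt_iff₀ hp, ← div_lt_iff₀' hd2]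
    linarith
  have hhp : ((p + 1 : ℕ) : ℝ) * (1 / ((p : ℝ) + 1)) = 1 := by push_cast; field_simp
  have hh1 : 1 / ((p : ℝ) + 1) ≤ 1 := by
    rw [div_le_one hp]
    have : (0:ℝ) ≤ p := p.cast_nonneg
    linarith
  have hh : 0 < 1 / ((p : ℝ) + 1) := by positivity
  set h := 1 / ((p : ℝ) + 1)
  have T := discreteTrajectory hg1D h x
  have hu : 0 < Useq g1 h (p + 1) x := (T.pos B hh hx (p + 1)).1
  have hxu : x < Useq g1 h (p + 1) x := T.strictMono B hh hx p.succ_pos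
  have hv := T.le_velocity B hh hx p
  have hE := T.energy_ge B hh hx (p + 1)
  have hE' := T.energy_variation_ge B hh hx (p + 1)
  have hlog := T.log_variation_ge B hh hx (p + 1)
  have hy := (T.variation_pos B hh hx (p + 1)).1
  have hEle := T.energy_le B hh hh1 hx (L := L) (p + 1) hhp.le
  obtain ⟨dU, dV⟩ := differentiable_Useq hg1D h (p + 1)
  have hvs : velocitySeq g1 h (p + 1) x =
    velocitySeq g1 h p x + h * g1 (Useq g1 h (p + 1) x) := rfl
  have hgxu := B.g_mono hx hu hxu.le
  have hW : g1 x ≤ velocitySeq g1 h (p + 1) x - h / 2 * g1 (Useq g1 h (p + 1) x) := by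
    have h1 : (p + 1 / 2) * h * g1 x ≤ velocitySeq g1 h p x := hv
    have h2 : h / 2 * g1 x ≤ h / 2 * g1 (Useq g1 h (p + 1) x) := by gcongr
    have h3 : ((p + 1 : ℕ) : ℝ) * h * g1 x = g1 x := by rw [hhp, one_mul]
    push_cast at h3
    linarith
  rw [discA_eq g1 g2 hh.ne', div_le_iff₀ (B2.g_pos hu)] at hA
  have hUC := hbound x _ _ hx hxu.le hW hE hA
  replace hEle := hEle (B.f_mono hu hC hUC)
  have hderiv : HasDerivAt (discA g1 g2 h (p + 2))
      (((deriv (velocitySeq g1 h (p + 1)) x - h / 2 * (deriv g1 (Useq g1 h (p + 1) x) *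
            deriv (Useq g1 h (p + 1)) x)) * g2 (Useq g1 h (p + 1) x) -
          (velocitySeq g1 h (p + 1) x - h / 2 * g1 (Useq g1 h (p + 1) x)) *
            (deriv g2 (Useq g1 h (p + 1) x) * deriv (Useq g1 h (p + 1)) x)) /
        g2 (Useq g1 h (p + 1) x) ^ 2) x := by
    rw [funext (discA_eq g1 g2 hh.ne' p)]
    exact ((dV x).hasDerivAt.sub
      (((hg1D _).hasDerivAt.comp x (dU x).hasDerivAt).const_mul (h / 2))).div
      ((hg2D _).hasDerivAt.comp x (dU x).hasDerivAt) (B2.g_pos hu).ne'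
  rw [hderiv.deriv]
  have hg2u := B2.g_pos hu
  have hH2u := hH2 _ hu
  have hg1u := B.g_pos hu
  have hGu := B.G_pos hu
  have hGx := B.G_pos hx
  have hGlt : 0 < primG1 g1 (Useq g1 h (p + 1) x) - primG1 g1 x :=
    lt_of_lt_of_le (mul_pos (B.g_pos hx) (sub_pos.2 hxu)) (B.G_sub_ge hx hxu.le)
  have hW0 := (B.g_pos hx).trans_le hW
  refine div_pos ?_ (pow_pos hg2u 2)
  rw [show Useq g1 h 0 x = x from rfl] at hE' hlog hEle
  generalize Useq g1 h (p + 1) x = U at *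
  generalize velocitySeq g1 h (p + 1) x - h / 2 * g1 U = W at *
  generalize deriv (Useq g1 h (p + 1)) x = y at *
  generalize deriv (velocitySeq g1 h (p + 1)) x - h / 2 * (deriv g1 U * y) = W' at *
  have hsum : 0 < 2 * W' * primG1 g1 U - d * g1 U * y * W := by
    have h1 : g1 U * y * (primG1 g1 U - primG1 g1 x) ≤ W * W' * primG1 g1 U := by
      have := mul_le_mul_of_nonneg_right hE' hGu.le
      linarith
    have h2 : d * W ^ 2 < 2 * (primG1 g1 U - primG1 g1 x) := by
      have h3 := mul_le_mul_of_nonneg_left hEle hd0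
      have h4 : d * (2 + h * (2 * L + L ^ 2)) < 2 := by nlinarith [sq_nonneg (1 - d)]
      have h5 := mul_lt_mul_of_pos_right h4 hGlt
      linarith
    have h6 := mul_lt_mul_of_pos_left h2 (mul_pos hg1u hy)
    refine pos_of_mul_pos_right (a := W) ?_ hW0.le
    linarith
  have hH : 2 * deriv g2 U * primG1 g1 U ≤ d * g1 U * g2 U := by
    rw [sub_nonneg, div_le_div_iff₀ hg2u hGu] at hH2u
    exact hH2u
  have h7 := mul_le_mul_of_nonneg_right hH (mul_pos hy hW0).le
  have h8 := mul_pos hsum hg2u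
  refine pos_of_mul_pos_right (a := 2 * primG1 g1 U) ?_ (by positivity)
  linarith
end
end

section
/- Let 𝒜 > 0 be given and assume the standing hypotheses (H1)–(H3) with constant d ∈ [0,1). Then there exists M(𝒜) > 0 with the following property: for every integer n > 1 + M(𝒜)/(2−2d) there exists c = c(n,𝒜) > 0 such that {u₁ > 0 : 0 < A(u₁) ≤ 𝒜} = (0, c], where A is defined with this n. -/
noncomputable section

/-- A function whose derivative is nonnegative to the right of `a` and which is nonnegative
at `a` stays nonnegative. -/
lemma nonneg_of_hasDerivAt_nonneg {f f' : ℝ → ℝ} {a x : ℝ}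
    (hf : ∀ y, HasDerivAt f (f' y) y) (hf' : ∀ y, a < y → 0 ≤ f' y) (ha : 0 ≤ f a)
    (hx : a ≤ x) : 0 ≤ f x := by
  have hmono : MonotoneOn f (Set.Ici a) := by
    refine monotoneOn_of_deriv_nonneg (convex_Ici a)
      (fun y _ => (hf y).continuousAt.continuousWithinAt)
      (fun y _ => (hf y).differentiableAt.differentiableWithinAt) fun y hy => ?_
    rw [interior_Ici] at hy
    rw [(hf y).deriv]
    exact hf' y hy
  exact ha.trans (hmono Set.self_mem_Ici hx hx)

/-- A continuous function which has positive derivative wherever it is at most `K` on `(0, ∞)`,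
is at most `K` near `0`, and exceeds `K` far away, has sublevel set `(0, c]`. -/
lemma exists_sublevel_eq_Ioc {f f' : ℝ → ℝ} {K B ε : ℝ}
    (hf : ∀ x, 0 < x → HasDerivAt f (f' x) x)
    (hpos : ∀ x, 0 < x → f x ≤ K → 0 < f' x)
    (hbdd : ∀ x, 0 < x → f x ≤ K → x ≤ B) (hε : 0 < ε) (hεK : f ε ≤ K) :
    ∃ c > (0 : ℝ), {x | 0 < x ∧ f x ≤ K} = Set.Ioc 0 c := by
  have hdown : ∀ u v, 0 < v → v < u → f u ≤ K → f v ≤ K := by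
    intro u v hv hvu hu
    by_contra! hKv
    have hcont : ContinuousOn f (Set.Icc v u) := fun y hy =>
      (hf y (hv.trans_le hy.1)).continuousAt.continuousWithinAt
    have hcl : IsClosed (Set.Icc v u ∩ f ⁻¹' Set.Iic K) :=
      hcont.preimage_isClosed_of_isClosed isClosed_Icc isClosed_Iic
    have hcomp : IsCompact (Set.Icc v u ∩ f ⁻¹' Set.Iic K) :=
      isCompact_Icc.of_isClosed_subset hcl Set.inter_subset_left
    obtain ⟨w, ⟨⟨hvw, hwu⟩, hwK⟩, hmin⟩ :=
      hcomp.exists_isLeast ⟨u, ⟨hvu.le, le_rfl⟩, hu⟩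
    simp only [Set.mem_preimage, Set.mem_Iic] at hwK
    have hvw' : v < w := lt_of_le_of_ne hvw fun h => by subst h; linarith
    have hw0 : 0 < w := hv.trans hvw'
    have hslope : ∀ᶠ y in nhdsWithin w {w}ᶜ, 0 < slope f w y :=
      ((hasDerivAt_iff_tendsto_slope.1 (hf w hw0)).eventually
        (lt_mem_nhds (hpos w hw0 hwK)))
    have hleft : ∀ᶠ y in nhdsWithin w (Set.Iio w), 0 < slope f w y :=
      hslope.filter_mono (nhdsWithin_mono _ fun y hy => ne_of_lt hy)
    obtain ⟨y, hy, hyv, hyw⟩ :=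
      (hleft.and (Ioo_mem_nhdsLT hvw')).exists
    have hfy : f y < f w := by
      rw [slope_def_field] at hy
      by_contra! h
      exact absurd hy (not_lt.2 (div_nonpos_of_nonneg_of_nonpos (by linarith) (by linarith)))
    have := hmin ⟨⟨hyv.le, (hyw.trans_le hwu).le⟩, (hfy.le.trans hwK : f y ≤ K)⟩
    linarith
  set S := {x | 0 < x ∧ f x ≤ K} with hS
  have hSb : BddAbove S := ⟨B, fun x hx => hbdd x hx.1 hx.2⟩
  have hεS : ε ∈ S := ⟨hε, hεK⟩
  have hc : 0 < sSup S := hε.trans_le (le_csSup hSb hεS)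
  have hlt : ∀ x, 0 < x → x < sSup S → f x ≤ K := by
    intro x hx hxs
    obtain ⟨u, hu, hxu⟩ := exists_lt_of_lt_csSup ⟨ε, hεS⟩ hxs
    exact hdown u x hx hxu hu.2
  refine ⟨sSup S, hc, Set.Subset.antisymm (fun x hx => ⟨hx.1, le_csSup hSb hx⟩) ?_⟩
  rintro x ⟨hx, hxc⟩
  refine ⟨hx, ?_⟩
  rcases hxc.lt_or_eq with h | rfl
  · exact hlt x hx h
  · refine le_of_tendsto ((hf _ hc).continuousAt.continuousWithinAt (s := Set.Iio (sSup S))) ?_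
    filter_upwards [Ioo_mem_nhdsLT hc] with y hy using hlt y hy.1 hy.2

/-- A `C³` function vanishing at `0`, with positive first derivative and nonnegative second and
third derivatives on `(0, ∞)`. -/
structure IsConvexSource (g : ℝ → ℝ) : Prop where
  contDiff : ContDiff ℝ 3 g
  zero : g 0 = 0
  deriv_pos : ∀ x > (0 : ℝ), 0 < deriv g x
  deriv2_nonneg : ∀ x > (0 : ℝ), 0 ≤ deriv (deriv g) x
  deriv3_nonneg : ∀ x > (0 : ℝ), 0 ≤ deriv (deriv (deriv g)) x

namespace IsConvexSource

variable {g : ℝ → ℝ}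

lemma hasDerivAt (hg : IsConvexSource g) (x : ℝ) : HasDerivAt g (deriv g x) x :=
  (hg.contDiff.differentiable (by norm_num) x).hasDerivAt

lemma contDiff_deriv (hg : IsConvexSource g) : ContDiff ℝ 2 (deriv g) :=
  (contDiff_succ_iff_deriv (n := 2).1 (by simpa [two_add_one_eq_three] using hg.contDiff)).2.2

lemma contDiff_deriv2 (hg : IsConvexSource g) : ContDiff ℝ 1 (deriv (deriv g)) :=
  (contDiff_succ_iff_deriv (n := 1).1
    (by simpa [one_add_one_eq_two] using hg.contDiff_deriv)).2.2

lemma hasDerivAt_deriv (hg : IsConvexSource g) (x : ℝ) :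
    HasDerivAt (deriv g) (deriv (deriv g) x) x :=
  (hg.contDiff_deriv.differentiable (by norm_num) x).hasDerivAt

lemma hasDerivAt_deriv2 (hg : IsConvexSource g) (x : ℝ) :
    HasDerivAt (deriv (deriv g)) (deriv (deriv (deriv g)) x) x :=
  (hg.contDiff_deriv2.differentiable (by norm_num) x).hasDerivAt

lemma hasDerivAt_primG1 (hg : IsConvexSource g) (x : ℝ) : HasDerivAt (primG1 g) (g x) x :=
  intervalIntegral.integral_hasDerivAt_right (hg.contDiff.continuous.intervalIntegrable _ _)
    (hg.contDiff.continuous.stronglyMeasurableAtFilter _ _) hg.contDiff.continuous.continuousAt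

lemma strictMonoOn (hg : IsConvexSource g) : StrictMonoOn g (Set.Ici 0) := by
  refine strictMonoOn_of_deriv_pos (convex_Ici 0) hg.contDiff.continuous.continuousOn ?_
  intro x hx
  rw [interior_Ici] at hx
  exact hg.deriv_pos x hx

lemma pos (hg : IsConvexSource g) {x : ℝ} (hx : 0 < x) : 0 < g x := by
  have := hg.strictMonoOn Set.self_mem_Ici (Set.mem_Ici.2 hx.le) hx
  rwa [hg.zero] at this

lemma mono (hg : IsConvexSource g) {a b : ℝ} (ha : 0 < a) (hab : a ≤ b) : g a ≤ g b :=
  hg.strictMonoOn.monotoneOn (Set.mem_Ici.2 ha.le) (Set.mem_Ici.2 (ha.le.trans hab)) hab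

lemma deriv_mono (hg : IsConvexSource g) {a b : ℝ} (ha : 0 < a) (hab : a ≤ b) :
    deriv g a ≤ deriv g b := by
  have := nonneg_of_hasDerivAt_nonneg (f := fun x => deriv g x - deriv g a)
    (fun y => (hg.hasDerivAt_deriv y).sub_const _)
    (fun y hy => hg.deriv2_nonneg y (ha.trans hy)) (by simp) hab
  linarith

lemma sub_le_deriv_mul (hg : IsConvexSource g) {a b : ℝ} (ha : 0 < a) (hab : a ≤ b) :
    g b - g a ≤ deriv g b * (b - a) := by
  have := nonneg_of_hasDerivAt_nonneg (f := fun x => deriv g x * (x - a) - (g x - g a))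
    (fun y => ((hg.hasDerivAt_deriv y).mul ((hasDerivAt_id y).sub_const a)).sub
      ((hg.hasDerivAt y).sub_const _))
    (fun y hy => by
      have := mul_nonneg (hg.deriv2_nonneg y (ha.trans hy)) (sub_nonneg.2 hy.le)
      simp only [id_eq]; linarith) (by simp) hab
  linarith

lemma sub_le_trapezoid (hg : IsConvexSource g) {a b : ℝ} (ha : 0 < a) (hab : a ≤ b) :
    g b - g a ≤ (deriv g a + deriv g b) / 2 * (b - a) := by
  have h2 : ∀ y, a ≤ y → deriv g y - deriv g a ≤ deriv (deriv g) y * (y - a) := by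
    intro y hy
    have := nonneg_of_hasDerivAt_nonneg
      (f := fun x => deriv (deriv g) x * (x - a) - (deriv g x - deriv g a))
      (fun y => ((hg.hasDerivAt_deriv2 y).mul ((hasDerivAt_id y).sub_const a)).sub
        ((hg.hasDerivAt_deriv y).sub_const _))
      (fun y hy => by
        have := mul_nonneg (hg.deriv3_nonneg y (ha.trans hy)) (sub_nonneg.2 hy.le)
        simp only [id_eq]; linarith) (by simp) hy
    linarith
  have := nonneg_of_hasDerivAt_nonneg
    (f := fun x => (deriv g a + deriv g x) / 2 * (x - a) - (g x - g a))
    (fun y => ((((hg.hasDerivAt_deriv y).const_add _).div_const 2).mul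
      ((hasDerivAt_id y).sub_const a)).sub ((hg.hasDerivAt y).sub_const _))
    (fun y hy => by
      have := h2 y hy.le
      simp only [id_eq]; linarith) (by simp) hab
  linarith

lemma primG1_zero : primG1 g 0 = 0 := by simp [primG1]

lemma mul_sub_le_primG1_sub (hg : IsConvexSource g) {a b : ℝ} (ha : 0 < a) (hab : a ≤ b) :
    g a * (b - a) ≤ primG1 g b - primG1 g a := by
  have := nonneg_of_hasDerivAt_nonneg
    (f := fun x => (primG1 g x - primG1 g a) - g a * (x - a))
    (fun y => ((hg.hasDerivAt_primG1 y).sub_const _).sub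
      (((hasDerivAt_id y).sub_const a).const_mul (g a)))
    (fun y hy => by
      have := hg.mono ha hy.le
      linarith) (by simp) hab
  linarith

lemma primG1_pos (hg : IsConvexSource g) {x : ℝ} (hx : 0 < x) : 0 < primG1 g x := by
  have h1 := hg.mul_sub_le_primG1_sub (half_pos hx) (half_le_self hx.le)
  have h2 := nonneg_of_hasDerivAt_nonneg hg.hasDerivAt_primG1
    (fun y hy => (hg.pos hy).le) primG1_zero.ge (half_pos hx).le
  have := mul_pos (hg.pos (half_pos hx)) (half_pos hx)
  linarith

lemma primG1_le_mul (hg : IsConvexSource g) {x : ℝ} (hx : 0 < x) : primG1 g x ≤ x * g x := by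
  have := nonneg_of_hasDerivAt_nonneg (f := fun y => y * g y - primG1 g y)
    (fun y => ((hasDerivAt_id y).mul (hg.hasDerivAt y)).sub (hg.hasDerivAt_primG1 y))
    (fun y hy => by
      have := mul_pos hy (hg.deriv_pos y hy)
      simp only [id_eq]; linarith) (by simp [primG1_zero]) hx.le
  linarith

lemma sq_le_two_mul_deriv_mul_primG1 (hg : IsConvexSource g) {x : ℝ} (hx : 0 < x) :
    g x ^ 2 ≤ 2 * deriv g x * primG1 g x := by
  have := nonneg_of_hasDerivAt_nonneg
    (f := fun y => 2 * (deriv g y * primG1 g y) - g y ^ 2)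
    (fun y => (((hg.hasDerivAt_deriv y).mul (hg.hasDerivAt_primG1 y)).const_mul 2).sub
      ((hg.hasDerivAt y).pow 2))
    (fun y hy => by
      have := mul_nonneg (hg.deriv2_nonneg y hy) (hg.primG1_pos hy).le
      norm_num; linarith) (by simp [primG1_zero, hg.zero]) hx.le
  linarith

/-- Comparison along the tangent flow: `a` is the initial value, `b` a later value. -/
lemma deriv_mul_le_of_lower_bound (hg : IsConvexSource g) {a b v : ℝ} (ha : 0 < a) (hab : a ≤ b)
    (hv : 1 + deriv g a / g a * (b - a) ≤ v) :
    deriv g a / g a * g b ≤ deriv g b * v := by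
  have hl : 0 ≤ deriv g a / g a := (div_pos (hg.deriv_pos a ha) (hg.pos ha)).le
  have := nonneg_of_hasDerivAt_nonneg
    (f := fun x => deriv g x * (1 + deriv g a / g a * (x - a)) - deriv g a / g a * g x)
    (fun y => ((hg.hasDerivAt_deriv y).mul
      ((((hasDerivAt_id y).sub_const a).const_mul (deriv g a / g a)).const_add 1)).sub
      ((hg.hasDerivAt y).const_mul _))
    (fun y hy => by
      have := mul_nonneg (hg.deriv2_nonneg y (ha.trans hy))
        (add_nonneg zero_le_one (mul_nonneg hl (sub_nonneg.2 hy.le)))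
      simp only [id_eq]; linarith)
    (by simp [div_mul_cancel₀ _ (hg.pos ha).ne']) hab
  have h2 := mul_le_mul_of_nonneg_left hv (hg.deriv_pos b (ha.trans_le hab)).le
  linarith

lemma mul_primG1_le_of_lower_bound (hg : IsConvexSource g) {a b v : ℝ} (ha : 0 < a)
    (hab : a ≤ b) (hv : 1 + deriv g a / g a * (b - a) ≤ v) :
    g a * primG1 g b ≤ g b * v * primG1 g a := by
  have hga := hg.pos ha
  have hGa := hg.primG1_pos ha
  have hsq : g a ≤ 2 * (deriv g a / g a) * primG1 g a := by
    have := hg.sq_le_two_mul_deriv_mul_primG1 ha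
    rw [show 2 * (deriv g a / g a) * primG1 g a = 2 * deriv g a * primG1 g a / g a by ring,
      le_div_iff₀ hga]
    linarith
  have := nonneg_of_hasDerivAt_nonneg
    (f := fun x => g x * (1 + deriv g a / g a * (x - a)) * primG1 g a - g a * primG1 g x)
    (fun y => (((hg.hasDerivAt y).mul
      ((((hasDerivAt_id y).sub_const a).const_mul (deriv g a / g a)).const_add 1)).mul_const
        (primG1 g a)).sub ((hg.hasDerivAt_primG1 y).const_mul _))
    (fun y hy => by
      have h1 := hg.deriv_mul_le_of_lower_bound ha hy.le le_rfl
      have h2 := mul_le_mul_of_nonneg_right h1 hGa.le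
      have h3 := mul_le_mul_of_nonneg_right hsq (hg.pos (ha.trans hy)).le
      simp only [id_eq]; nlinarith) (by simp) hab
  have h2 := mul_le_mul_of_nonneg_right
    (mul_le_mul_of_nonneg_left hv (hg.pos (ha.trans_le hab)).le) hGa.le
  linarith

end IsConvexSource

/-- The derivative of `Useq g h k` with respect to the initial value. -/
def UseqDeriv (g : ℝ → ℝ) (h : ℝ) : ℕ → ℝ → ℝ
  | 0 => fun _ => 1
  | 1 => fun x => 1 + h ^ 2 / 2 * deriv g x
  | k + 2 => fun x =>
      2 * UseqDeriv g h (k + 1) x - UseqDeriv g h k x +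
        h ^ 2 * (deriv g (Useq g h (k + 1) x) * UseqDeriv g h (k + 1) x)

/-- Twice the trapezoidal approximation of `∫ g` over the nodes `Useq g h 0, …, Useq g h k`. -/
def trapSum (g : ℝ → ℝ) (h : ℝ) (k : ℕ) (x : ℝ) : ℝ :=
  ∑ j ∈ Finset.range k, (g (Useq g h j x) + g (Useq g h (j + 1) x)) *
    (Useq g h (j + 1) x - Useq g h j x)

/-- The derivative of `trapSum g h k`. -/
def trapSumDeriv (g : ℝ → ℝ) (h : ℝ) (k : ℕ) (x : ℝ) : ℝ :=
  ∑ j ∈ Finset.range k,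
    ((deriv g (Useq g h j x) * UseqDeriv g h j x +
        deriv g (Useq g h (j + 1) x) * UseqDeriv g h (j + 1) x) *
        (Useq g h (j + 1) x - Useq g h j x) +
      (g (Useq g h j x) + g (Useq g h (j + 1) x)) *
        (UseqDeriv g h (j + 1) x - UseqDeriv g h j x))

namespace IsConvexSource

variable {g : ℝ → ℝ} {h x : ℝ}

lemma hasDerivAt_Useq (hg : IsConvexSource g) (h x : ℝ) (k : ℕ) :
    HasDerivAt (Useq g h k) (UseqDeriv g h k x) x := by
  induction k using Nat.twoStepInduction with
  | zero => exact hasDerivAt_id x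
  | one => exact (hasDerivAt_id x).add ((hg.hasDerivAt x).const_mul _)
  | more k ih0 ih1 =>
    exact ((ih1.const_mul 2).sub ih0).add
      (((hg.hasDerivAt (Useq g h (k + 1) x)).comp x ih1).const_mul _)

lemma hasDerivAt_trapSum (hg : IsConvexSource g) (h x : ℝ) (k : ℕ) :
    HasDerivAt (trapSum g h k) (trapSumDeriv g h k x) x := by
  refine HasDerivAt.fun_sum fun j _ => ?_
  have h0 := hg.hasDerivAt_Useq h x j
  have h1 := hg.hasDerivAt_Useq h x (j + 1)
  exact (((hg.hasDerivAt _).comp x h0).add ((hg.hasDerivAt _).comp x h1)).mul (h1.sub h0)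

lemma Useq_zero (hg : IsConvexSource g) (h : ℝ) (k : ℕ) : Useq g h k 0 = 0 := by
  induction k using Nat.twoStepInduction with
  | zero => rfl
  | one => simp [Useq, hg.zero]
  | more k ih0 ih1 => simp [Useq, ih0, ih1, hg.zero]

lemma Useq_succ_bounds (hg : IsConvexSource g) (hh : 0 < h) (hx : 0 < x) (k : ℕ) :
    x ≤ Useq g h k x ∧
    h ^ 2 * (k + 1 / 2) * g x ≤ Useq g h (k + 1) x - Useq g h k x ∧
    Useq g h (k + 1) x - Useq g h k x ≤ h ^ 2 * (k + 1 / 2) * g (Useq g h k x) := by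
  have hgx := hg.pos hx
  have hh2 : 0 < h ^ 2 := by positivity
  induction k with
  | zero =>
    simp only [Useq, Nat.cast_zero]
    refine ⟨le_rfl, ?_, ?_⟩ <;> linarith
  | succ k ih =>
    obtain ⟨h1, h2, h3⟩ := ih
    have hc : 0 < h ^ 2 * ((k : ℝ) + 1 / 2) := by positivity
    have hle : Useq g h k x ≤ Useq g h (k + 1) x := by
      have := mul_pos hc hgx
      linarith
    have hxk := h1.trans hle
    have hg1 := hg.mono (hx.trans_le h1) hle
    have hg2 := hg.mono hx hxk
    have e : Useq g h (k + 1 + 1) x - Useq g h (k + 1) x =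
        (Useq g h (k + 1) x - Useq g h k x) + h ^ 2 * g (Useq g h (k + 1) x) := by
      simp only [Useq]; ring
    refine ⟨hxk, ?_, ?_⟩
    · rw [e]
      push_cast
      nlinarith
    · rw [e]
      push_cast
      nlinarith

lemma Useq_lt_succ (hg : IsConvexSource g) (hh : 0 < h) (hx : 0 < x) (k : ℕ) :
    Useq g h k x < Useq g h (k + 1) x := by
  have := (hg.Useq_succ_bounds hh hx k).2.1
  have hc : 0 < h ^ 2 * ((k : ℝ) + 1 / 2) * g x := mul_pos (by positivity) (hg.pos hx)
  linarith

lemma Useq_pos (hg : IsConvexSource g) (hh : 0 < h) (hx : 0 < x) (k : ℕ) :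
    0 < Useq g h k x :=
  hx.trans_le (hg.Useq_succ_bounds hh hx k).1

lemma UseqDeriv_bounds (hg : IsConvexSource g) (hh : 0 < h) (hx : 0 < x) (k : ℕ) :
    1 + deriv g x / g x * (Useq g h k x - x) ≤ UseqDeriv g h k x ∧
    deriv g x / g x * (Useq g h (k + 1) x - Useq g h k x) ≤
      UseqDeriv g h (k + 1) x - UseqDeriv g h k x := by
  induction k with
  | zero =>
    simp only [Useq, UseqDeriv]
    have := div_mul_cancel₀ (deriv g x) (hg.pos hx).ne'
    constructor
    · simp
    · apply le_of_eq
      linear_combination (h ^ 2 / 2) * this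
  | succ k ih =>
    obtain ⟨h1, h2⟩ := ih
    have h3 : 1 + deriv g x / g x * (Useq g h (k + 1) x - x) ≤ UseqDeriv g h (k + 1) x := by
      linarith
    refine ⟨h3, ?_⟩
    have h4 := mul_le_mul_of_nonneg_left (hg.deriv_mul_le_of_lower_bound hx
      (hg.Useq_succ_bounds hh hx (k + 1)).1 h3) (sq_nonneg h)
    simp only [Useq, UseqDeriv] at *
    linarith

lemma UseqDeriv_le_succ (hg : IsConvexSource g) (hh : 0 < h) (hx : 0 < x) (k : ℕ) :
    UseqDeriv g h k x ≤ UseqDeriv g h (k + 1) x := by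
  have := mul_nonneg (div_pos (hg.deriv_pos x hx) (hg.pos hx)).le
    (sub_pos.2 (hg.Useq_lt_succ hh hx k)).le
  have := (hg.UseqDeriv_bounds hh hx k).2
  linarith

lemma UseqDeriv_pos (hg : IsConvexSource g) (hh : 0 < h) (hx : 0 < x) (k : ℕ) :
    0 < UseqDeriv g h k x := by
  have := mul_nonneg (div_pos (hg.deriv_pos x hx) (hg.pos hx)).le
    (sub_nonneg.2 (hg.Useq_succ_bounds hh hx k).1)
  have := (hg.UseqDeriv_bounds hh hx k).1
  linarith

/-- Discrete energy identity. -/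
lemma energy_identity (g : ℝ → ℝ) {h : ℝ} (hh : h ≠ 0) (x : ℝ) (k : ℕ) :
    ((Useq g h (k + 1) x - Useq g h k x) / h + h / 2 * g (Useq g h (k + 1) x)) ^ 2 =
      trapSum g h (k + 1) x +
        h ^ 2 / 4 * (g (Useq g h (k + 1) x) ^ 2 - g x ^ 2) := by
  induction k with
  | zero =>
    simp only [trapSum, Useq, zero_add, Finset.sum_range_one]
    field_simp
    ring
  | succ k ih =>
    rw [trapSum, Finset.sum_range_succ, ← trapSum]
    have e : (Useq g h (k + 1 + 1) x - Useq g h (k + 1) x) / h =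
        (Useq g h (k + 1) x - Useq g h k x) / h + h * g (Useq g h (k + 1) x) := by
      simp only [Useq]
      field_simp
      ring
    have e2 : Useq g h (k + 1 + 1) x - Useq g h (k + 1) x =
        h * ((Useq g h (k + 1) x - Useq g h k x) / h + h * g (Useq g h (k + 1) x)) := by
      rw [← e]; field_simp
    rw [e, e2]
    linear_combination ih

lemma le_trapSumDeriv (hg : IsConvexSource g) (hh : 0 < h) (hx : 0 < x) (k : ℕ) :
    2 * (g (Useq g h k x) * UseqDeriv g h k x - g x) ≤ trapSumDeriv g h k x := by
  have hsum : ∑ j ∈ Finset.range k, (g (Useq g h (j + 1) x) * UseqDeriv g h (j + 1) x -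
      g (Useq g h j x) * UseqDeriv g h j x) = g (Useq g h k x) * UseqDeriv g h k x - g x := by
    rw [Finset.sum_range_sub (fun j => g (Useq g h j x) * UseqDeriv g h j x)]
    simp [Useq, UseqDeriv]
  rw [← hsum, Finset.mul_sum]
  refine Finset.sum_le_sum fun j _ => ?_
  have ha := hg.Useq_pos hh hx j
  have hab := (hg.Useq_lt_succ hh hx j).le
  have hu := hg.UseqDeriv_pos hh hx j
  have huv := hg.UseqDeriv_le_succ hh hx j
  have h1 := mul_nonneg hu.le (sub_nonneg.2 (hg.sub_le_trapezoid ha hab))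
  have h2 := mul_nonneg (sub_nonneg.2 huv) (sub_nonneg.2 (hg.sub_le_deriv_mul ha hab))
  nlinarith

lemma two_mul_primG1_sub_le_trapSum (hg : IsConvexSource g) (hh : 0 < h) (hx : 0 < x) (k : ℕ) :
    2 * (primG1 g (Useq g h k x) - primG1 g x) ≤ trapSum g h k x := by
  have hsum : ∑ j ∈ Finset.range k, (primG1 g (Useq g h (j + 1) x) - primG1 g (Useq g h j x)) =
      primG1 g (Useq g h k x) - primG1 g x := by
    rw [Finset.sum_range_sub (fun j => primG1 g (Useq g h j x))]
    simp [Useq]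
  rw [← hsum, Finset.mul_sum]
  refine Finset.sum_le_sum fun j _ => ?_
  have ha := hg.Useq_pos hh hx j
  have hab := (hg.Useq_lt_succ hh hx j).le
  generalize Useq g h j x = a at *
  generalize Useq g h (j + 1) x = b at *
  have := nonneg_of_hasDerivAt_nonneg
    (f := fun y => (g a + g y) * (y - a) - 2 * (primG1 g y - primG1 g a))
    (fun y => ((((hg.hasDerivAt y).const_add (g a))).mul
      ((hasDerivAt_id y).sub_const a)).sub
        (((hg.hasDerivAt_primG1 y).sub_const _).const_mul 2))
    (fun y hy => by
      have := hg.sub_le_deriv_mul ha hy.le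
      simp only [id_eq]; linarith) (by simp) hab
  linarith

lemma Useq_mono (hg : IsConvexSource g) (hh : 0 < h) (hx : 0 < x) :
    StrictMono fun k => Useq g h k x :=
  strictMono_nat_of_lt_succ fun k => hg.Useq_lt_succ hh hx k

lemma trapSum_le (hg : IsConvexSource g) (hh : 0 < h) (hx : 0 < x) {N : ℕ}
    (hN : h * N = 1) {M : ℝ} (hM : deriv g (Useq g h N x) ≤ M) :
    trapSum g h N x ≤ (2 + h * M) * (primG1 g (Useq g h N x) - primG1 g x) := by
  have hsum : ∑ j ∈ Finset.range N, (primG1 g (Useq g h (j + 1) x) - primG1 g (Useq g h j x)) =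
      primG1 g (Useq g h N x) - primG1 g x := by
    rw [Finset.sum_range_sub (fun j => primG1 g (Useq g h j x))]
    simp [Useq]
  rw [← hsum, Finset.mul_sum]
  refine Finset.sum_le_sum fun j hj => ?_
  have hjN : j + 1 ≤ N := Finset.mem_range.1 hj
  have ha := hg.Useq_pos hh hx j
  have hab := (hg.Useq_lt_succ hh hx j).le
  have hbM : deriv g (Useq g h (j + 1) x) ≤ M :=
    (hg.deriv_mono (hg.Useq_pos hh hx (j + 1)) ((hg.Useq_mono hh hx).monotone hjN)).trans hM
  have hstep : Useq g h (j + 1) x - Useq g h j x ≤ h * g (Useq g h j x) := by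
    refine (hg.Useq_succ_bounds hh hx j).2.2.trans ?_
    have hj1 : (j : ℝ) + 1 ≤ N := by exact_mod_cast hjN
    have : h * ((j : ℝ) + 1 / 2) ≤ 1 := by nlinarith
    have h2 := mul_le_mul_of_nonneg_right this (mul_pos hh (hg.pos ha)).le
    linarith
  generalize Useq g h j x = a at *
  generalize Useq g h (j + 1) x = b at *
  have hb : 0 < b := ha.trans_le hab
  have hM0 : 0 ≤ M := (hg.deriv_pos b hb).le.trans hbM
  have h1 := hg.sub_le_deriv_mul ha hab
  have h2 : deriv g b * (b - a) ≤ M * (h * g a) :=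
    mul_le_mul hbM hstep (sub_nonneg.2 hab) hM0
  have h3 : g a + g b ≤ (2 + h * M) * g a := by linarith
  have h4 := mul_le_mul_of_nonneg_right h3 (sub_nonneg.2 hab)
  have h5 := mul_le_mul_of_nonneg_left (hg.mul_sub_le_primG1_sub ha hab)
    (by positivity : 0 ≤ 2 + h * M)
  linarith

/-- The logarithmic derivative of the energy dominates `d` times that of `primG1 g` at the
endpoint. -/
lemma energy_deriv_pos (hg : IsConvexSource g) (hh : 0 < h) (hx : 0 < x) {N : ℕ}
    (hN : h * N = 1) {M d : ℝ} (hM : deriv g (Useq g h N x) ≤ M) (hd : 0 ≤ d) (hd1 : d < 1)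
    (hdM : h * M < 2 - 2 * d) :
    d * (trapSum g h N x + h ^ 2 / 4 * (g (Useq g h N x) ^ 2 - g x ^ 2)) *
        (g (Useq g h N x) * UseqDeriv g h N x) <
      (trapSumDeriv g h N x + h ^ 2 / 4 * (2 * g (Useq g h N x) *
        (deriv g (Useq g h N x) * UseqDeriv g h N x) - 2 * g x * deriv g x)) *
          primG1 g (Useq g h N x) := by
  have hN0 : 0 < N := by
    rcases Nat.eq_zero_or_pos N with rfl | h0
    · simp at hN
    · exact h0
  have hxb : x < Useq g h N x := by simpa [Useq] using hg.Useq_mono hh hx hN0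
  have hT := hg.trapSum_le hh hx hN hM
  have hT' := hg.le_trapSumDeriv hh hx N
  have hv := (hg.UseqDeriv_bounds hh hx N).1
  have hv0 := hg.UseqDeriv_pos hh hx N
  have hQP := hg.mul_primG1_le_of_lower_bound hx hxb.le hv
  have hs := hg.deriv_mul_le_of_lower_bound hx hxb.le hv
  generalize trapSum g h N x = T at *
  generalize trapSumDeriv g h N x = T' at *
  generalize UseqDeriv g h N x = v at *
  generalize Useq g h N x = b at *
  have hb : 0 < b := hx.trans hxb
  have hgx := hg.pos hx
  have hgb := hg.pos hb
  have hgxb := hg.mono hx hxb.le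
  have hP := hg.primG1_pos hb
  have hsq := hg.sq_le_two_mul_deriv_mul_primG1 hb
  have hPQ : 0 < primG1 g b - primG1 g x :=
    (mul_pos hgx (sub_pos.2 hxb)).trans_le (hg.mul_sub_le_primG1_sub hx hxb.le)
  generalize primG1 g b = P at *
  generalize primG1 g x = Q at *
  have hM0 : 0 ≤ M := (hg.deriv_pos b hb).le.trans hM
  have hgv : 0 < g b * v := mul_pos hgb hv0
  have htrap : d * T * (g b * v) < T' * P := by
    have hfac : d * (2 + h * M) < 2 := by nlinarith [mul_nonneg hh.le hM0]
    have h1 : d * T ≤ d * (2 + h * M) * (P - Q) := by nlinarith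
    have h2 : d * (2 + h * M) * (P - Q) < 2 * (P - Q) := mul_lt_mul_of_pos_right hfac hPQ
    have h3 := mul_lt_mul_of_pos_right (h1.trans_lt h2) hgv
    have h4 := mul_le_mul_of_nonneg_right hT' hP.le
    nlinarith
  have hrest : d * (g b ^ 2 - g x ^ 2) * (g b * v) ≤
      (2 * g b * (deriv g b * v) - 2 * g x * deriv g x) * P := by
    have hdiff : 0 ≤ g b ^ 2 - g x ^ 2 := by nlinarith
    have h1 : g x * deriv g x * g b ≤ g x ^ 2 * (deriv g b * v) := by
      have e : deriv g x / g x * g b = deriv g x * g b / g x := by ring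
      rw [e, div_le_iff₀ hgx] at hs
      nlinarith
    have h2 : (g b ^ 2 - g x ^ 2) * (deriv g b * v) ≤
        (g b * (deriv g b * v) - g x * deriv g x) * g b := by linarith
    have h3 : (g b ^ 2 - g x ^ 2) * (g b ^ 2 * v) ≤
        (2 * g b * (deriv g b * v) - 2 * g x * deriv g x) * P * g b := by
      have h4 := mul_le_mul_of_nonneg_left hsq (mul_nonneg hdiff hv0.le)
      have h5 := mul_le_mul_of_nonneg_right h2 (mul_pos two_pos hP).le
      linarith
    have h6 : (g b ^ 2 - g x ^ 2) * (g b * v) ≤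
        (2 * g b * (deriv g b * v) - 2 * g x * deriv g x) * P := by
      refine le_of_mul_le_mul_right ?_ hgb
      linarith
    have h7 := mul_le_mul_of_nonneg_right hd1.le (mul_nonneg hdiff hgv.le)
    linarith
  have := mul_le_mul_of_nonneg_left hrest (by positivity : 0 ≤ h ^ 2 / 4)
  linarith

end IsConvexSource

/-- The function `A`, with the index of the endpoint shifted by one. -/
lemma discA_succ (g1 g2 : ℝ → ℝ) (h : ℝ) (k : ℕ) (x : ℝ) :
    discA g1 g2 h (k + 2) x =
      ((Useq g1 h (k + 1) x - Useq g1 h k x) / h + h / 2 * g1 (Useq g1 h (k + 1) x)) /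
        g2 (Useq g1 h (k + 1) x) := rfl

/-- The squared numerator of `A`, via the energy identity. -/
def energy (g : ℝ → ℝ) (h : ℝ) (N : ℕ) (x : ℝ) : ℝ :=
  trapSum g h N x + h ^ 2 / 4 * (g (Useq g h N x) ^ 2 - g x ^ 2)

lemma sq_discA (g1 g2 : ℝ → ℝ) {h : ℝ} (hh : h ≠ 0) (k : ℕ) (x : ℝ) :
    discA g1 g2 h (k + 2) x ^ 2 =
      energy g1 h (k + 1) x / g2 (Useq g1 h (k + 1) x) ^ 2 := by
  rw [discA_succ, div_pow, IsConvexSource.energy_identity g1 hh, energy]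

namespace IsConvexSource

variable {g1 g2 : ℝ → ℝ} {h x : ℝ}

lemma numerator_bounds (hg : IsConvexSource g1) (hh : 0 < h) (hx : 0 < x) {k : ℕ}
    (hN : h * (k + 1 : ℕ) = 1) :
    g1 x ≤ (Useq g1 h (k + 1) x - Useq g1 h k x) / h + h / 2 * g1 (Useq g1 h (k + 1) x) ∧
    (Useq g1 h (k + 1) x - Useq g1 h k x) / h + h / 2 * g1 (Useq g1 h (k + 1) x) ≤
      g1 (Useq g1 h (k + 1) x) := by
  push_cast at hN
  obtain ⟨h1, h2, h3⟩ := hg.Useq_succ_bounds hh hx k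
  have hab := (hg.Useq_lt_succ hh hx k).le
  have hg1 := hg.mono (hg.Useq_pos hh hx k) hab
  have hg2 := hg.mono hx (h1.trans hab)
  have e : h * ((k : ℝ) + 1 / 2) = 1 - h / 2 := by linarith
  have hk : 0 ≤ 1 - h / 2 := by rw [← e]; positivity
  have h2' : (1 - h / 2) * g1 x ≤ (Useq g1 h (k + 1) x - Useq g1 h k x) / h := by
    rw [le_div_iff₀ hh, ← e]; linarith
  have h3' : (Useq g1 h (k + 1) x - Useq g1 h k x) / h ≤ (1 - h / 2) * g1 (Useq g1 h k x) := by
    rw [div_le_iff₀ hh, ← e]; linarith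
  constructor
  · nlinarith
  · nlinarith

lemma discA_pos (hg : IsConvexSource g1) (hg2 : ∀ y > 0, 0 < g2 y) (hh : 0 < h) (hx : 0 < x)
    {k : ℕ} (hN : h * (k + 1 : ℕ) = 1) : 0 < discA g1 g2 h (k + 2) x := by
  rw [discA_succ]
  exact div_pos ((hg.pos hx).trans_le (hg.numerator_bounds hh hx hN).1)
    (hg2 _ (hg.Useq_pos hh hx _))

/-- A bound on the endpoint value which is uniform in the mesh size. -/
lemma Useq_le_of_discA_le (hg : IsConvexSource g1) (hg2 : ∀ y > 0, 0 < g2 y)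
    (hgmono : StrictMonoOn (gg g1 g2) (Set.Ioi 0))
    (hGmono : StrictMonoOn (GG g1 g2) (Set.Ioi 0))
    {K y z : ℝ} (hy : 0 < y) (hGy : GG g1 g2 y = K ^ 2) (hz : 0 < z) (hgz : gg g1 g2 z = 2 * K)
    (hh : 0 < h) (hx : 0 < x) {k : ℕ} (hN : h * (k + 1 : ℕ) = 1)
    (hA : discA g1 g2 h (k + 2) x ≤ K) :
    Useq g1 h (k + 1) x ≤ max y (2 * z) := by
  by_contra! hlt
  obtain ⟨hyb, hzb⟩ := max_lt_iff.1 hlt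
  have hV := (hg.numerator_bounds hh hx hN).1
  have hE := energy_identity g1 hh.ne' x k
  have hT := hg.two_mul_primG1_sub_le_trapSum hh hx (k + 1)
  have hxb := (hg.Useq_succ_bounds hh hx (k + 1)).1
  rw [discA_succ] at hA
  generalize (Useq g1 h (k + 1) x - Useq g1 h k x) / h + h / 2 * g1 (Useq g1 h (k + 1) x) = V at *
  generalize trapSum g1 h (k + 1) x = T at *
  generalize Useq g1 h (k + 1) x = b at *
  have hb : 0 < b := hx.trans_le hxb
  have hgx := hg.pos hx
  have hgxb := hg.mono hx hxb
  have hQ := hg.primG1_pos hx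
  have h2x := hg2 x hx
  have h2b := hg2 b hb
  rw [div_le_iff₀ h2b] at hA
  have hGb := hGmono hy hb hyb
  rw [hGy, GG, lt_div_iff₀ (by positivity)] at hGb
  have hGxb := hGmono.monotoneOn hx hb hxb
  rw [GG, GG, div_le_div_iff₀ (by positivity) (by positivity)] at hGxb
  have hVsq : V ^ 2 ≤ K ^ 2 * g2 b ^ 2 := by
    rw [← mul_pow]
    exact pow_le_pow_left₀ (hgx.le.trans hV) hA 2
  have hrest : 0 ≤ h ^ 2 / 4 * (g1 b ^ 2 - g1 x ^ 2) :=
    mul_nonneg (by positivity) (by nlinarith)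
  have hPQ : primG1 g1 b < 2 * primG1 g1 x := by linarith
  have hb2x : b ≤ 2 * x := by
    by_contra! hcon
    have h1 := hg.mul_sub_le_primG1_sub hx hxb
    have h2 := hg.primG1_le_mul hx
    nlinarith
  have hg2sq : g2 b ^ 2 < 2 * g2 x ^ 2 := by
    have h1 := mul_lt_mul_of_pos_right hPQ (by positivity : 0 < g2 x ^ 2)
    refine lt_of_mul_lt_mul_left ?_ hQ.le
    linarith
  have hg2le : g2 b ≤ 2 * g2 x := by nlinarith
  have hK : 0 ≤ K := by
    by_contra! hcon
    nlinarith
  have hxz : x ≤ z := by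
    refine (hgmono.le_iff_le hx hz).1 ?_
    rw [hgz, gg, div_le_iff₀ h2x]
    nlinarith
  linarith

/-- The derivative of `energy g h N`. -/
lemma hasDerivAt_energy (hg : IsConvexSource g1) (h x : ℝ) (N : ℕ) :
    HasDerivAt (energy g1 h N)
      (trapSumDeriv g1 h N x + h ^ 2 / 4 * (2 * g1 (Useq g1 h N x) *
        (deriv g1 (Useq g1 h N x) * UseqDeriv g1 h N x) - 2 * g1 x * deriv g1 x)) x := by
  have h1 := (hg.hasDerivAt (Useq g1 h N x)).comp x (hg.hasDerivAt_Useq h x N)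
  refine ((hg.hasDerivAt_trapSum h x N).add
    (((h1.pow 2).sub ((hg.hasDerivAt x).pow 2)).const_mul (h ^ 2 / 4))).congr_deriv ?_
  simp only [Function.comp_apply, Nat.cast_ofNat, Nat.add_one_sub_one, pow_one]

end IsConvexSource

theorem stmt_14
    (g1 g2 : ℝ → ℝ)
    (hg1C : ContDiff ℝ 3 g1) (hg2C : ContDiff ℝ 3 g2)
    (hg10 : g1 0 = 0) (hg20 : g2 0 = 0)
    (hg1d : ∀ x > (0:ℝ), 0 < deriv g1 x) (hg2d : ∀ x > (0:ℝ), 0 < deriv g2 x)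
    (hg1dd : ∀ x > (0:ℝ), 0 < deriv (deriv g1) x)
    (hg2dd : ∀ x > (0:ℝ), 0 < deriv (deriv g2) x)
    (hg1ddd : ∀ x > (0:ℝ), 0 ≤ deriv (deriv (deriv g1)) x)
    (hg2ddd : ∀ x > (0:ℝ), 0 ≤ deriv (deriv (deriv g2)) x)
    (𝒜 : ℝ) (h𝒜 : 0 < 𝒜)
    (hgmono : StrictMonoOn (gg g1 g2) (Set.Ioi 0))
    (hgbij : Set.BijOn (gg g1 g2) (Set.Ioi 0) (Set.Ioi 0))
    (hGmono : StrictMonoOn (GG g1 g2) (Set.Ioi 0))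
    (hGbij : Set.BijOn (GG g1 g2) (Set.Ioi 0) (Set.Ioi 0))
    (d : ℝ) (hd0 : 0 ≤ d) (hd1 : d < 1)
    (hH2 : ∀ x > (0:ℝ), 0 ≤ d * g1 x / primG1 g1 x - 2 * deriv g2 x / g2 x)
    (hH3 : ∀ x > (0:ℝ), 0 ≤ deriv (deriv (GG g1 g2)) x) :
    ∃ M > (0:ℝ), ∀ n : ℕ, 1 + M / (2 - 2 * d) < (n : ℝ) →
      ∃ c > (0:ℝ),
        {u1 : ℝ | 0 < u1 ∧ 0 < discA g1 g2 (1 / ((n : ℝ) - 1)) n u1 ∧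
          discA g1 g2 (1 / ((n : ℝ) - 1)) n u1 ≤ 𝒜} = Set.Ioc 0 c := by
  have hg1 : IsConvexSource g1 :=
    ⟨hg1C, hg10, hg1d, fun x hx => (hg1dd x hx).le, hg1ddd⟩
  have hg2 : IsConvexSource g2 :=
    ⟨hg2C, hg20, hg2d, fun x hx => (hg2dd x hx).le, hg2ddd⟩
  have hg2pos : ∀ y > 0, 0 < g2 y := fun y hy => hg2.pos hy
  obtain ⟨y, hy, hGy⟩ := hGbij.surjOn (Set.mem_Ioi.2 (by positivity : 0 < 𝒜 ^ 2))
  obtain ⟨z, hz, hgz⟩ := hgbij.surjOn (Set.mem_Ioi.2 (by positivity : 0 < 2 * 𝒜))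
  obtain ⟨w, hw, hgw⟩ := hgbij.surjOn (Set.mem_Ioi.2 h𝒜)
  rw [Set.mem_Ioi] at hy hz hw
  have hB : 0 < max y (2 * z) := lt_max_of_lt_left hy
  refine ⟨deriv g1 (max y (2 * z)), hg1d _ hB, fun n hn => ?_⟩
  have hM := hg1d _ hB
  generalize hBdef : max y (2 * z) = B at *
  have hd2 : 0 < 2 - 2 * d := by linarith
  have hn1 : (1 : ℝ) < n := by
    have := div_pos hM hd2
    linarith
  obtain ⟨k, rfl⟩ : ∃ k, n = k + 2 := ⟨n - 2, by
    have : 1 < n := by exact_mod_cast hn1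
    omega⟩
  have hN1 : ((k + 2 : ℕ) : ℝ) - 1 = (k + 1 : ℕ) := by push_cast; ring
  rw [← lt_sub_iff_add_lt', hN1] at hn
  rw [hN1]
  have hNpos : (0 : ℝ) < (k + 1 : ℕ) := by positivity
  have hh : (0 : ℝ) < 1 / (k + 1 : ℕ) := by positivity
  have hN : (1 : ℝ) / (k + 1 : ℕ) * (k + 1 : ℕ) = 1 := one_div_mul_cancel hNpos.ne'
  have hhM : (1 : ℝ) / (k + 1 : ℕ) * deriv g1 B < 2 - 2 * d := by
    rw [one_div_mul_eq_div, div_lt_iff₀ hNpos]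
    rw [div_lt_iff₀ hd2] at hn
    linarith
  generalize (1 : ℝ) / (k + 1 : ℕ) = h at *
  have hApos : ∀ x, 0 < x → 0 < discA g1 g2 h (k + 2) x := fun x hx =>
    hg1.discA_pos hg2pos hh hx hN
  have hAB : ∀ x, 0 < x → discA g1 g2 h (k + 2) x ≤ 𝒜 → Useq g1 h (k + 1) x ≤ B := by
    intro x hx hA
    rw [← hBdef]
    exact hg1.Useq_le_of_discA_le hg2pos hgmono hGmono hy hGy hz hgz hh hx hN hA
  have hiff : ∀ x, 0 < x → (energy g1 h (k + 1) x / g2 (Useq g1 h (k + 1) x) ^ 2 ≤ 𝒜 ^ 2 ↔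
      discA g1 g2 h (k + 2) x ≤ 𝒜) := by
    intro x hx
    rw [← sq_discA g1 g2 hh.ne', sq_le_sq₀ (hApos x hx).le h𝒜.le]
  obtain ⟨ε, hε, hεw⟩ : ∃ ε > 0, Useq g1 h (k + 1) ε ≤ w := by
    have hcont := (hg1.hasDerivAt_Useq h 0 (k + 1)).continuousAt
    have hev : ∀ᶠ x in nhds (0 : ℝ), Useq g1 h (k + 1) x < w :=
      hcont.eventually (gt_mem_nhds (by rwa [hg1.Useq_zero]))
    obtain ⟨ε, h1, h2⟩ := ((hev.filter_mono nhdsWithin_le_nhds).and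
      (self_mem_nhdsWithin (s := Set.Ioi (0 : ℝ)))).exists
    exact ⟨ε, h2, h1.le⟩
  have hεA : discA g1 g2 h (k + 2) ε ≤ 𝒜 := by
    have hb := hg1.Useq_pos hh hε (k + 1)
    rw [discA_succ]
    refine (div_le_div_of_nonneg_right (hg1.numerator_bounds hh hε hN).2 (hg2pos _ hb).le).trans ?_
    rw [← hgw]
    exact hgmono.monotoneOn hb hw hεw
  have hderiv : ∀ x, 0 < x → HasDerivAt
      (fun x => energy g1 h (k + 1) x / g2 (Useq g1 h (k + 1) x) ^ 2) _ x := fun x hx =>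
    (hg1.hasDerivAt_energy h x (k + 1)).div
      (((hg2.hasDerivAt _).comp x (hg1.hasDerivAt_Useq h x (k + 1))).pow 2)
      (pow_pos (hg2pos _ (hg1.Useq_pos hh hx (k + 1))) 2).ne'
  have hsub := exists_sublevel_eq_Ioc (K := 𝒜 ^ 2) (B := B) (ε := ε) hderiv
  refine (hsub ?_ (fun x hx hA => (hg1.Useq_succ_bounds hh hx (k + 1)).1.trans
      (hAB x hx ((hiff x hx).1 hA))) hε ((hiff ε hε).2 hεA)).imp ?_
  · intro x hx hA
    have hb := hg1.Useq_pos hh hx (k + 1)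
    have hMb := hg1.deriv_mono hb (hAB x hx ((hiff x hx).1 hA))
    have hE := hg1.energy_deriv_pos hh hx hN hMb hd0 hd1 hhM
    have hv := hg1.UseqDeriv_pos hh hx (k + 1)
    have hEpos : 0 < energy g1 h (k + 1) x := by
      have := pow_pos (hApos x hx) 2
      rw [sq_discA g1 g2 hh.ne'] at this
      exact (div_pos_iff_of_pos_right (pow_pos (hg2pos _ hb) 2)).1 this
    rw [← energy] at hE
    have h2b := hg2pos _ hb
    have hP := hg1.primG1_pos hb
    have hH := hH2 _ hb
    refine div_pos ?_ (by positivity)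
    simp only [Function.comp_apply, Nat.cast_ofNat, Nat.add_one_sub_one, pow_one]
    generalize trapSumDeriv g1 h (k + 1) x + _ = W' at *
    generalize energy g1 h (k + 1) x = W at *
    generalize UseqDeriv g1 h (k + 1) x = v at *
    generalize Useq g1 h (k + 1) x = b at *
    rw [sub_nonneg, div_le_div_iff₀ h2b hP] at hH
    have h1 := mul_le_mul_of_nonneg_right hH (mul_pos hEpos hv).le
    have h2 := mul_lt_mul_of_pos_right hE h2b
    have h3 : 2 * W * deriv g2 b * v < W' * g2 b := by
      refine lt_of_mul_lt_mul_right ?_ hP.le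
      linarith
    have h4 := mul_lt_mul_of_pos_right h3 h2b
    linarith
  · rintro c ⟨hc, hset⟩
    refine ⟨hc, ?_⟩
    rw [← hset]
    ext x
    exact ⟨fun hx => ⟨hx.1, (hiff x hx.1).2 hx.2.2⟩,
      fun hx => ⟨hx.1, hApos x hx.1, (hiff x hx.1).1 hx.2⟩⟩
end
end
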